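/- arXiv:1802.02839 — 4 statements merged into one kernel-verified Lean document; each statement's English description precedes it below -/
import Mathlib

section
/- Let q0, qx, qy, qxy ∈ ℝ² and define the vertex family v(i,j) = q0 + i·qx + j·qy + (i·j)·qxy for i,j ∈ ℝ. For integers i,j let r_{ij} : [-1,1]² → ℝ² be the bilinear map r_{ij}(ξ,η) = v(i,j)·Φ₋₁,₋₁(ξ,η) + v(i+1,j)·Φ₁,₋₁(ξ,η) + v(i+1,j+1)·Φ₁,₁(ξ,η) + v(i,j+1)·Φ₋₁,₁(ξ,η), and let J^{(i,j)}(ξ,η) be its 2×2 Jacobian matrix of partial derivatives with respect to (ξ,η). Then the Jacobian is an affine function of the element index (i,j): for all integers i,j and all (ξ,η), J^{(i,j)}(ξ,η) = J^{(0,0)}(ξ,η) + i·(J^{(1,0)}(ξ,η) − J^{(0,0)}(ξ,η)) + j·(J^{(0,1)}(ξ,η) − J^{(0,0)}(ξ,η)). -/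
noncomputable section

/-- Bilinear Lagrange shape function on `[-1,1]²` associated with corner `(sx, sy)`,
where `sx, sy ∈ {-1, 1}`:  `Φ_{sx,sy}(ξ,η) = (1 + sx·ξ)(1 + sy·η)/4`. -/
def Phi (sx sy ξ η : ℝ) : ℝ := (1 + sx * ξ) * (1 + sy * η) / 4

/-- The vertex family `v(i,j) = q0 + i·qx + j·qy + (i·j)·qxy`. -/
def vtx (q0 qx qy qxy : Fin 2 → ℝ) (i j : ℝ) : Fin 2 → ℝ :=
  q0 + i • qx + j • qy + (i * j) • qxy

/-- The bilinear map `r_{ij}(ξ,η)` interpolating the four vertices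
`v(i,j), v(i+1,j), v(i+1,j+1), v(i,j+1)` with the shape functions. -/
def rmap (q0 qx qy qxy : Fin 2 → ℝ) (i j : ℤ) (ξ η : ℝ) : Fin 2 → ℝ :=
  Phi (-1) (-1) ξ η • vtx q0 qx qy qxy (i : ℝ) (j : ℝ)
    + Phi 1 (-1) ξ η • vtx q0 qx qy qxy ((i : ℝ) + 1) (j : ℝ)
    + Phi 1 1 ξ η • vtx q0 qx qy qxy ((i : ℝ) + 1) ((j : ℝ) + 1)
    + Phi (-1) 1 ξ η • vtx q0 qx qy qxy (i : ℝ) ((j : ℝ) + 1)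

/-- The `2×2` Jacobian matrix of `r_{ij}` at `(ξ,η)`: first column is the partial
derivative with respect to `ξ`, second column with respect to `η`. -/
def Jac (q0 qx qy qxy : Fin 2 → ℝ) (i j : ℤ) (ξ η : ℝ) : Matrix (Fin 2) (Fin 2) ℝ :=
  Matrix.of fun a b : Fin 2 =>
    if b = 0 then deriv (fun t => rmap q0 qx qy qxy i j t η a) ξ
    else deriv (fun t => rmap q0 qx qy qxy i j ξ t a) η

/-- The element map is the vertex family evaluated at the shifted, rescaled reference point. -/
lemma rmap_eq_vtx (q0 qx qy qxy : Fin 2 → ℝ) (i j : ℤ) (ξ η : ℝ) :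
    rmap q0 qx qy qxy i j ξ η = vtx q0 qx qy qxy (i + (1 + ξ) / 2) (j + (1 + η) / 2) := by
  ext a
  simp only [rmap, vtx, Phi, Pi.add_apply, Pi.smul_apply, smul_eq_mul]
  ring

lemma hasDerivAt_vtx_left (q0 qx qy qxy : Fin 2 → ℝ) (s t : ℝ) (a : Fin 2) :
    HasDerivAt (fun u => vtx q0 qx qy qxy u t a) (qx a + t * qxy a) s := by
  have h := ((hasDerivAt_id s).mul_const (qx a + t * qxy a)).add_const (q0 a + t * qy a)
  refine (h.congr_deriv (one_mul _)).congr_of_eventuallyEq (.of_forall fun u => ?_)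
  simp only [vtx, Pi.add_apply, Pi.smul_apply, smul_eq_mul, id]
  ring

lemma vtx_swap (q0 qx qy qxy : Fin 2 → ℝ) (s t : ℝ) :
    vtx q0 qx qy qxy s t = vtx q0 qy qx qxy t s := by
  simp only [vtx, mul_comm s t, add_right_comm]

lemma deriv_rmap_left (q0 qx qy qxy : Fin 2 → ℝ) (i j : ℤ) (ξ η : ℝ) (a : Fin 2) :
    deriv (fun t => rmap q0 qx qy qxy i j t η a) ξ =
      (qx a + (j + (1 + η) / 2) * qxy a) * (1 / 2) := by
  simp only [rmap_eq_vtx]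
  have h : HasDerivAt (fun t : ℝ => (i : ℝ) + (1 + t) / 2) (1 / 2) ξ :=
    (((hasDerivAt_id ξ).const_add 1).div_const 2).const_add _
  exact ((hasDerivAt_vtx_left q0 qx qy qxy _ _ a).comp ξ h).deriv

lemma rmap_swap (q0 qx qy qxy : Fin 2 → ℝ) (i j : ℤ) (ξ η : ℝ) :
    rmap q0 qx qy qxy i j ξ η = rmap q0 qy qx qxy j i η ξ := by
  rw [rmap_eq_vtx, rmap_eq_vtx, vtx_swap]

lemma deriv_rmap_right (q0 qx qy qxy : Fin 2 → ℝ) (i j : ℤ) (ξ η : ℝ) (a : Fin 2) :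
    deriv (fun t => rmap q0 qx qy qxy i j ξ t a) η =
      (qy a + (i + (1 + ξ) / 2) * qxy a) * (1 / 2) := by
  simp only [rmap_swap q0 qx, deriv_rmap_left]

/-- The Jacobian matrix is an affine function of the element index `(i,j)`. -/
theorem jacobian_affine_in_index (q0 qx qy qxy : Fin 2 → ℝ) (i j : ℤ) (ξ η : ℝ) :
    Jac q0 qx qy qxy i j ξ η =
      Jac q0 qx qy qxy 0 0 ξ η
        + (i : ℝ) • (Jac q0 qx qy qxy 1 0 ξ η - Jac q0 qx qy qxy 0 0 ξ η)
        + (j : ℝ) • (Jac q0 qx qy qxy 0 1 ξ η - Jac q0 qx qy qxy 0 0 ξ η) := by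
  ext a b
  simp only [Jac, deriv_rmap_left, deriv_rmap_right, Matrix.add_apply, Matrix.smul_apply,
    Matrix.sub_apply, Matrix.of_apply, smul_eq_mul, Int.cast_zero, Int.cast_one]
  split_ifs <;> ring

end
end

section
/- QTT representation of the left-side selection matrix: let d ≥ 1. For s, i, j ∈ {0,…,2^d−1} with binary digits s_k, i_k, j_k (least significant first) and z_k = i_k + 2·j_k, define Ψ_L(s, (i,j)) = 1 if i = 0 and j = 2^d − 1 − s, and 0 otherwise. Then Ψ_L(s,(i,j)) = Π_{k=1}^d P(s_k, z_k), where P is the 2×4 matrix P = [[0,0,1,0],[1,0,0,0]]; equivalently, i = 0 and j = 2^d − 1 − s if and only if z_k = 2 − 2·s_k for every k ∈ {1,…,d}. -/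
/-- The `k`-th binary digit (least significant first, `k = 0, 1, …`) of a natural
number `n`, so that `n = Σ_k 2^k · (digit k n)`. -/
def digit (k n : ℕ) : Fin 2 := ⟨n / 2 ^ k % 2, Nat.mod_lt _ two_pos⟩

/-- The `k`-th z-order digit of the pair `(i, j)`: `z_k = i_k + 2·j_k ∈ {0,1,2,3}`. -/
def zdigit (k i j : ℕ) : Fin 4 :=
  ⟨(digit k i).val + 2 * (digit k j).val, by
    have h1 := (digit k i).isLt
    have h2 := (digit k j).isLt
    omega⟩

/-- The `2×4` QTT core of the left-side selection matrix. -/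
def PL : Matrix (Fin 2) (Fin 4) ℝ := !![0, 0, 1, 0; 1, 0, 0, 0]

theorem digit_zero (n : ℕ) : (digit 0 n : ℕ) = n % 2 := by
  simp [digit]

theorem digit_succ (k n : ℕ) : digit (k + 1) n = digit k (n / 2) := by
  simp [digit, pow_succ', Nat.div_div_eq_div_mul]

theorem zdigit_val (k i j : ℕ) :
    (zdigit k i j : ℕ) = (digit k i : ℕ) + 2 * (digit k j : ℕ) := rfl

theorem zdigit_succ (k i j : ℕ) : zdigit (k + 1) i j = zdigit k (i / 2) (j / 2) := by
  simp only [zdigit, digit_succ]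

theorem eq_zero_and_eq_complement_iff_zdigit (d : ℕ) :
    ∀ s i j : ℕ, s < 2 ^ d → i < 2 ^ d → j < 2 ^ d →
      ((i = 0 ∧ j = 2 ^ d - 1 - s) ↔
        ∀ k < d, (zdigit k i j : ℕ) = 2 - 2 * (digit k s : ℕ)) := by
  induction d with
  | zero =>
    intro s i j hs hi hj
    simp at *
    omega
  | succ d ih =>
    intro s i j hs hi hj
    rw [pow_succ] at *
    have h := ih (s / 2) (i / 2) (j / 2) (by omega) (by omega) (by omega)
    rw [Nat.forall_lt_succ_left]
    simp only [zdigit_succ, digit_succ]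
    rw [← h, zdigit_val]
    simp only [digit_zero]
    omega

theorem PL_apply (a : Fin 2) (z : Fin 4) :
    PL a z = if (z : ℕ) = 2 - 2 * (a : ℕ) then 1 else 0 := by
  fin_cases a <;> fin_cases z <;> simp [PL]

/-- QTT representation of the left-side selection matrix
`Ψ_L(s,(i,j)) = [i = 0 ∧ j = 2^d − 1 − s]`: its entries factor as the product over the
digits, `Ψ_L(s,(i,j)) = Π_k P(s_k, z_k)` with `P = [[0,0,1,0],[1,0,0,0]]`; equivalently
`i = 0 ∧ j = 2^d − 1 − s ↔ ∀ k < d, z_k = 2 − 2·s_k`. -/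
theorem psi_left_qtt (d : ℕ) (hd : 1 ≤ d) (s i j : ℕ)
    (hs : s < 2 ^ d) (hi : i < 2 ^ d) (hj : j < 2 ^ d) :
    ((if i = 0 ∧ j = 2 ^ d - 1 - s then (1 : ℝ) else 0) =
        ∏ k ∈ Finset.range d, PL (digit k s) (zdigit k i j)) ∧
      ((i = 0 ∧ j = 2 ^ d - 1 - s) ↔
        ∀ k < d, (zdigit k i j : ℕ) = 2 - 2 * (digit k s : ℕ)) := by
  have h := eq_zero_and_eq_complement_iff_zdigit d s i j hs hi hj
  refine ⟨?_, h⟩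
  simp only [PL_apply, Finset.prod_ite_zero, Finset.prod_const_one, Finset.mem_range, h]
end

section
/- Kronecker-sum representation of the masked identity W₀: let d ≥ 1 and define the 2^d×2^d real matrix W₀ by W₀(e,p) = 1 if e = p and e ≠ 2^d − 1, and 0 otherwise. Let M, R, L be the 2×2 matrices M = [[1,0],[0,0]], R = I₂ (identity), L = [[0,0],[0,1]]. Then for all e, p ∈ {0,…,2^d−1} with binary digits e_l, p_l (least significant first), W₀(e,p) = Σ_{k=1}^d (Π_{l=1}^{k−1} L(e_l,p_l)) · M(e_k,p_k) · (Π_{l=k+1}^{d} R(e_l,p_l)); equivalently W₀ equals the sum over k of the d-fold Kronecker-type products with factor L in positions l < k, factor M in position k, and factor R in positions l > k (factors indexed so that position l acts on the l-th binary digit). -/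
/-- Middle factor for `W₀`. -/
def M0 : Matrix (Fin 2) (Fin 2) ℝ := !![1, 0; 0, 0]

/-- Right factor for `W₀` (identity). -/
def R0 : Matrix (Fin 2) (Fin 2) ℝ := !![1, 0; 0, 1]

/-- Left factor for `W₀`. -/
def L0 : Matrix (Fin 2) (Fin 2) ℝ := !![0, 0; 0, 1]

/-- Entries of the `d`-fold Kronecker power of `L0`. -/
theorem prod_L0_digit (d e p : ℕ) :
    ∏ l ∈ Finset.range d, L0 (digit l e) (digit l p) =
      if e % 2 ^ d = 2 ^ d - 1 ∧ p % 2 ^ d = 2 ^ d - 1 then 1 else 0 := by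
  induction d with
  | zero => simp [Nat.mod_one]
  | succ d ih =>
    rw [Finset.prod_range_succ, ih, Nat.mod_pow_succ, Nat.mod_pow_succ, pow_succ]
    have he := Nat.mod_lt e (Nat.two_pow_pos d)
    have hp := Nat.mod_lt p (Nat.two_pow_pos d)
    rcases Nat.mod_two_eq_zero_or_one (e / 2 ^ d) with hx | hx <;>
    rcases Nat.mod_two_eq_zero_or_one (p / 2 ^ d) with hy | hy <;>
    simp only [digit, hx, hy] <;> simp [L0] <;> grind

/-- The Kronecker sum for digits of arbitrary naturals, which sees only their residues
modulo `2 ^ d`. -/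
theorem sum_kronecker_digit (d e p : ℕ) :
    ∑ k ∈ Finset.range d,
        (∏ l ∈ Finset.range k, L0 (digit l e) (digit l p)) *
          M0 (digit k e) (digit k p) *
          (∏ l ∈ Finset.Ico (k + 1) d, R0 (digit l e) (digit l p)) =
      if e % 2 ^ d = p % 2 ^ d ∧ e % 2 ^ d ≠ 2 ^ d - 1 then 1 else 0 := by
  induction d with
  | zero => simp [Nat.mod_one]
  | succ d ih =>
    have hstep : ∀ k ∈ Finset.range d,
        (∏ l ∈ Finset.range k, L0 (digit l e) (digit l p)) *
          M0 (digit k e) (digit k p) *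
          (∏ l ∈ Finset.Ico (k + 1) (d + 1), R0 (digit l e) (digit l p)) =
        (∏ l ∈ Finset.range k, L0 (digit l e) (digit l p)) *
          M0 (digit k e) (digit k p) *
          (∏ l ∈ Finset.Ico (k + 1) d, R0 (digit l e) (digit l p)) *
          R0 (digit d e) (digit d p) := fun k hk => by
      rw [Finset.prod_Ico_succ_top (Finset.mem_range.mp hk), mul_assoc _ _ (R0 _ _)]
    rw [Finset.sum_range_succ, Finset.sum_congr rfl hstep, ← Finset.sum_mul, ih,
      Finset.Ico_self, Finset.prod_empty, mul_one, prod_L0_digit, Nat.mod_pow_succ,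
      Nat.mod_pow_succ, pow_succ]
    have he := Nat.mod_lt e (Nat.two_pow_pos d)
    have hp := Nat.mod_lt p (Nat.two_pow_pos d)
    rcases Nat.mod_two_eq_zero_or_one (e / 2 ^ d) with hx | hx <;>
    rcases Nat.mod_two_eq_zero_or_one (p / 2 ^ d) with hy | hy <;>
    simp only [digit, hx, hy] <;> simp [M0, R0] <;> grind

/-- Kronecker-sum representation of the masked identity `W₀`, defined by
`W₀(e,p) = [e = p ∧ e ≠ 2^d − 1]`: its entries equal the sum over `k` of the d-fold
Kronecker-type products with factor `L` in positions `l < k`, factor `M` in position `k`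
and factor `R` in positions `l > k` (position `l` acting on the `l`-th binary digit). -/
theorem W0_kronecker_sum (d : ℕ) (hd : 1 ≤ d) (e p : ℕ)
    (he : e < 2 ^ d) (hp : p < 2 ^ d) :
    (if e = p ∧ e ≠ 2 ^ d - 1 then (1 : ℝ) else 0) =
      ∑ k ∈ Finset.range d,
        (∏ l ∈ Finset.range k, L0 (digit l e) (digit l p)) *
          M0 (digit k e) (digit k p) *
          (∏ l ∈ Finset.Ico (k + 1) d, R0 (digit l e) (digit l p)) := by
  rw [sum_kronecker_digit, Nat.mod_eq_of_lt he, Nat.mod_eq_of_lt hp]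
end

section
/- Kronecker-sum representation of the shift matrix W₁: let d ≥ 1 and define the 2^d×2^d real matrix W₁ by W₁(e,p) = 1 if p = e + 1, and 0 otherwise (the superdiagonal shift matrix). Let M, R, L be the 2×2 matrices M = [[0,1],[0,0]], R = I₂ (identity), L = [[0,0],[1,0]]. Then for all e, p ∈ {0,…,2^d−1} with binary digits e_l, p_l (least significant first), W₁(e,p) = Σ_{k=1}^d (Π_{l=1}^{k−1} L(e_l,p_l)) · M(e_k,p_k) · (Π_{l=k+1}^{d} R(e_l,p_l)). -/
/-- Middle factor for `W₁`. -/
def M1 : Matrix (Fin 2) (Fin 2) ℝ := !![0, 1; 0, 0]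

/-- Right factor for `W₁` (identity). -/
def R1 : Matrix (Fin 2) (Fin 2) ℝ := !![1, 0; 0, 1]

/-- Left factor for `W₁`. -/
def L1 : Matrix (Fin 2) (Fin 2) ℝ := !![0, 0; 1, 0]

theorem digit_zero_val (n : ℕ) : (digit 0 n).val = n % 2 := by
  simp [digit]

theorem M1_apply (i j : Fin 2) : M1 i j = if i.val = 0 ∧ j.val = 1 then 1 else 0 := by
  fin_cases i <;> fin_cases j <;> simp [M1]

theorem R1_apply (i j : Fin 2) : R1 i j = if i.val = j.val then 1 else 0 := by
  fin_cases i <;> fin_cases j <;> simp [R1]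

theorem L1_apply (i j : Fin 2) : L1 i j = if i.val = 1 ∧ j.val = 0 then 1 else 0 := by
  fin_cases i <;> fin_cases j <;> simp [L1]

theorem prod_R1_digit (d e p : ℕ) (he : e < 2 ^ d) (hp : p < 2 ^ d) :
    ∏ l ∈ Finset.range d, R1 (digit l e) (digit l p) = if e = p then 1 else 0 := by
  induction d generalizing e p with
  | zero => simp_all
  | succ d ih =>
    rw [Finset.prod_range_succ']
    simp only [digit_succ]
    rw [ih (e / 2) (p / 2) (by omega) (by omega), R1_apply, digit_zero_val, digit_zero_val]
    split_ifs <;> first | omega | norm_num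

/-- The representation for every number of digits, including zero. -/
theorem shift_eq_sum_prod_digit (d e p : ℕ) (he : e < 2 ^ d) (hp : p < 2 ^ d) :
    (if p = e + 1 then (1 : ℝ) else 0) =
      ∑ k ∈ Finset.range d,
        (∏ l ∈ Finset.range k, L1 (digit l e) (digit l p)) *
          M1 (digit k e) (digit k p) *
          (∏ l ∈ Finset.Ico (k + 1) d, R1 (digit l e) (digit l p)) := by
  induction d generalizing e p with
  | zero => simp_all
  | succ d ih =>
    have he' : e / 2 < 2 ^ d := by omega
    have hp' : p / 2 < 2 ^ d := by omega
    have tail : ∏ l ∈ Finset.Ico 1 (d + 1), R1 (digit l e) (digit l p) =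
        if e / 2 = p / 2 then 1 else 0 := by
      rw [← prod_R1_digit d _ _ he' hp', Finset.prod_Ico_eq_prod_range]
      simp only [add_comm 1, digit_succ, Nat.add_sub_cancel]
    rw [Finset.sum_range_succ']
    simp only [Finset.prod_range_succ', ← Finset.prod_Ico_add', digit_succ, zero_add,
      Finset.prod_range_zero, one_mul]
    rw [tail]
    simp only [mul_right_comm _ (L1 _ _), ← Finset.sum_mul]
    rw [← ih _ _ he' hp', L1_apply, M1_apply, digit_zero_val, digit_zero_val]
    split_ifs <;> first | omega | norm_num

/-- Kronecker-sum representation of the superdiagonal shift matrix `W₁`, defined by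
`W₁(e,p) = [p = e + 1]`: its entries equal the sum over `k` of the d-fold Kronecker-type
products with factor `L` in positions `l < k`, factor `M` in position `k` and factor `R`
in positions `l > k` (position `l` acting on the `l`-th binary digit). -/
theorem W1_kronecker_sum (d : ℕ) (hd : 1 ≤ d) (e p : ℕ)
    (he : e < 2 ^ d) (hp : p < 2 ^ d) :
    (if p = e + 1 then (1 : ℝ) else 0) =
      ∑ k ∈ Finset.range d,
        (∏ l ∈ Finset.range k, L1 (digit l e) (digit l p)) *
          M1 (digit k e) (digit k p) *
          (∏ l ∈ Finset.Ico (k + 1) d, R1 (digit l e) (digit l p)) :=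
  shift_eq_sum_prod_digit d e p he hp
end
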